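/- There exists a constant C > 0 such that the following holds for every n ≥ 2, every connected initial graph G₀ on n vertices, and every vertex u. Let T = ⌈C·n·ln n⌉. Then the probability (over the trajectory of the triangulation process started at G₀) of the event that both (i) for every round t < T, every vertex of N_t¹(u) is weakly tied to N_t²(u), and (ii) d_T(u) < min{(1 + 1/8)·δ₀, n − 1}, is at most 1/n². -/

import Mathlib

open scoped Classical

noncomputable section

variable {V : Type} [Fintype V] [DecidableEq V]

/-- The neighbors of `v` in `G`, as a `Finset`. -/
def nbr (G : SimpleGraph V) (v : V) : Finset V := Finset.univ.filter (fun w => G.Adj v w)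

/-- The degree `d(v)` of `v` in `G`. -/
def deg (G : SimpleGraph V) (v : V) : ℕ := (nbr G v).card

/-- The minimum degree of `G`. -/
def minDeg (G : SimpleGraph V) : ℕ := sInf (Set.range (deg G))

/-- `Nk G u i` is the set `Nⁱ(u)` of vertices at graph distance exactly `i` from `u`. -/
def Nk (G : SimpleGraph V) (u : V) (i : ℕ) : Finset V :=
  Finset.univ.filter (fun v => v ≠ u ∧ G.dist u v = i)

/-- `degIn G v S` is `d(v, S)`, the number of neighbors of `v` lying in `S`. -/
def degIn (G : SimpleGraph V) (v : V) (S : Finset V) : ℕ := (nbr G v ∩ S).card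

/-- The graph obtained from a choice function `c` in one round of the triangulation
process: every vertex `w` adds the edge joining the ordered pair `c w` of its chosen
neighbors (edges are unordered, loops are discarded, all additions are simultaneous). -/
def triNext (G : SimpleGraph V) (c : V → V × V) : SimpleGraph V :=
  G ⊔ SimpleGraph.fromEdgeSet {e | ∃ v : V, e = s((c v).1, (c v).2)}

/-- The probability that in one round of the triangulation process on the current
graph `G` the vertices make exactly the choices recorded by `c`: each vertex with at
least one neighbor independently picks an ordered pair of its neighbors uniformly at
random with replacement; isolated vertices are given the dummy choice `(v, v)`. -/
def triWeight (G : SimpleGraph V) (c : V → V × V) : ℝ :=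
  ∏ v : V,
    if deg G v = 0 then (if c v = (v, v) then 1 else 0)
    else if (c v).1 ∈ nbr G v ∧ (c v).2 ∈ nbr G v then (1 : ℝ) / (deg G v : ℝ) ^ 2 else 0

/-- Transition probability of one round of the triangulation process. -/
def triStep (G G' : SimpleGraph V) : ℝ :=
  ∑ c : V → V × V, if triNext G c = G' then triWeight G c else 0

/-- The graph obtained from a choice function `c` in one round of the two-hop walk
process: every vertex `u` adds the edge to the endpoint `(c u).2` of its two-hop walk
(loops are discarded, all additions are simultaneous). -/
def hopNext (G : SimpleGraph V) (c : V → V × V) : SimpleGraph V :=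
  G ⊔ SimpleGraph.fromEdgeSet {e | ∃ u : V, e = s(u, (c u).2)}

/-- The probability that in one round of the two-hop walk process on the current graph
`G` the vertices make exactly the choices recorded by `c`: each vertex `u` with at
least one neighbor independently picks a uniformly random neighbor `v = (c u).1` and
then a uniformly random neighbor `w = (c u).2` of `v`; isolated vertices are given the
dummy choice `(u, u)`. -/
def hopWeight (G : SimpleGraph V) (c : V → V × V) : ℝ :=
  ∏ u : V,
    if deg G u = 0 then (if c u = (u, u) then 1 else 0)
    else if (c u).1 ∈ nbr G u ∧ (c u).2 ∈ nbr G (c u).1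
      then (1 : ℝ) / ((deg G u : ℝ) * (deg G (c u).1 : ℝ)) else 0

/-- Transition probability of one round of the two-hop walk process. -/
def hopStep (G G' : SimpleGraph V) : ℝ :=
  ∑ c : V → V × V, if hopNext G c = G' then hopWeight G c else 0

/-- `trajProb step g0 T E` is the probability, for the Markov chain on a finite state
space `Γ` with one-step transition probabilities `step` started at `g0`, that the
trajectory `(g_0, g_1, …, g_T)` satisfies the event `E`; probabilities are realized as
a probability mass function on finite sequences of states.  (The trajectory is passed
to `E` as a function on `ℕ`, frozen at time `T`.) -/
def trajProb {Γ : Type} [Fintype Γ] (step : Γ → Γ → ℝ) (g0 : Γ) (T : ℕ)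
    (E : (ℕ → Γ) → Prop) : ℝ :=
  ∑ s : Fin (T + 1) → Γ,
    if s 0 = g0 ∧ E (fun t => s ⟨min t T, Nat.lt_succ_of_le (Nat.min_le_right t T)⟩)
    then ∏ t : Fin T, step (s t.castSucc) (s t.succ) else 0

end

/-- **Supermartingale bound.** If `h` does not increase in mean along the steps that start in
`A t` and is at least `1` on `A T`, then the mass of the trajectories staying in `A` up to
time `T` is at most the initial value of `h`. -/
lemma sum_path_le_of_supermartingale {Γ : Type} [Fintype Γ] (step : Γ → Γ → ℝ)
    (hstep : ∀ a b, 0 ≤ step a b) (T : ℕ) (A : ℕ → Γ → Prop) (h : ℕ → Γ → ℝ)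
    (h0 : ∀ t g, 0 ≤ h t g) (hT : ∀ g, A T g → 1 ≤ h T g)
    (hs : ∀ t < T, ∀ g, A t g → ∑ g', step g g' * h (t + 1) g' ≤ h t g) (g0 : Γ) :
    ∑ s : Fin (T + 1) → Γ,
      (if s 0 = g0 ∧ ∀ i : Fin (T + 1), A i (s i)
        then ∏ t : Fin T, step (s t.castSucc) (s t.succ) else 0) ≤ h 0 g0 := by
  induction T generalizing A h g0 with
  | zero =>
    by_cases hA : A 0 g0
    · refine le_trans ?_ (hT g0 hA)
      rw [Finset.sum_eq_single (fun _ => g0)]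
      · simp [hA]
      · intro s _ hne
        rw [if_neg]
        rintro ⟨h1, -⟩
        exact hne (funext fun i => by
          obtain rfl : i = 0 := by omega
          exact h1)
      · simp
    · refine le_trans (le_of_eq (Finset.sum_eq_zero fun s _ => ?_)) (h0 0 g0)
      rw [if_neg]
      rintro ⟨h1, h2⟩
      exact hA (h1 ▸ h2 0)
  | succ T ih =>
    by_cases hA : A 0 g0
    · refine le_trans ?_ (hs 0 (Nat.succ_pos T) g0 hA)
      have key := fun g1 => ih (fun t => A (t + 1)) (fun t => h (t + 1))
        (fun t g => h0 _ g) hT (fun t ht g hg => hs (t + 1) (by omega) g hg) g1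
      rw [← (Fin.consEquiv (fun _ : Fin (T + 2) => Γ)).sum_comp, Fintype.sum_prod_type]
      rw [Finset.sum_eq_single g0]
      · calc _ = ∑ s : Fin (T + 1) → Γ, ∑ g1, step g0 g1 *
              (if s 0 = g1 ∧ ∀ i : Fin (T + 1), A (i + 1) (s i)
              then ∏ t : Fin T, step (s t.castSucc) (s t.succ) else 0) := by
              refine Finset.sum_congr rfl fun s _ => ?_
              rw [Finset.sum_eq_single (s 0)]
              · simp [Fin.consEquiv, Fin.forall_fin_succ (n := T + 1), hA,
                  Fin.prod_univ_succ (n := T)]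
              · intro g _ hne
                rw [if_neg, mul_zero]
                exact fun hh => hne hh.1.symm
              · simp
          _ ≤ _ := by
              rw [Finset.sum_comm]
              refine Finset.sum_le_sum fun g1 _ => ?_
              rw [← Finset.mul_sum]
              exact mul_le_mul_of_nonneg_left (key g1) (hstep _ _)
      · intro g _ hne
        refine Finset.sum_eq_zero fun s _ => ?_
        rw [if_neg]
        rintro ⟨h1, -⟩
        exact hne (by simpa [Fin.consEquiv] using h1)
      · simp
    · refine le_trans (le_of_eq (Finset.sum_eq_zero fun s _ => ?_)) (h0 0 g0)
      rw [if_neg]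
      rintro ⟨h1, h2⟩
      exact hA (h1 ▸ h2 0)

section OneRound

lemma le_triNext {V : Type} (G : SimpleGraph V) (c : V → V × V) : G ≤ triNext G c := le_sup_left

lemma triNext_adj {V : Type} {G : SimpleGraph V} {c : V → V × V} {v a b : V} (hc : c v = (a, b))
    (hab : a ≠ b) : (triNext G c).Adj a b := by
  refine (SimpleGraph.sup_adj _ _ _ _).2 (Or.inr ?_)
  rw [SimpleGraph.fromEdgeSet_adj]
  exact ⟨⟨v, by rw [hc]⟩, hab⟩

variable {V : Type} [Fintype V]

lemma mem_nbr {G : SimpleGraph V} {v w : V} : w ∈ nbr G v ↔ G.Adj v w := by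
  simp [nbr]

lemma nbr_mono {G H : SimpleGraph V} (h : G ≤ H) (v : V) : nbr G v ⊆ nbr H v := by
  intro w hw
  exact mem_nbr.2 (h (mem_nbr.1 hw))

lemma deg_mono {G H : SimpleGraph V} (h : G ≤ H) (v : V) : deg G v ≤ deg H v :=
  Finset.card_le_card (nbr_mono h v)

lemma minDeg_le_deg (G : SimpleGraph V) (v : V) : minDeg G ≤ deg G v :=
  Nat.sInf_le ⟨v, rfl⟩

variable [DecidableEq V]

/-- The law of the pair selected by the single vertex `v` in one round. -/
noncomputable def pairWeight (G : SimpleGraph V) (v : V) (p : V × V) : ℝ :=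
  if deg G v = 0 then (if p = (v, v) then 1 else 0)
  else if p.1 ∈ nbr G v ∧ p.2 ∈ nbr G v then (1 : ℝ) / (deg G v : ℝ) ^ 2 else 0

lemma pairWeight_nonneg (G : SimpleGraph V) (v : V) (p : V × V) : 0 ≤ pairWeight G v p := by
  unfold pairWeight
  split_ifs <;> positivity

lemma sum_pairWeight_of_subset {G : SimpleGraph V} {v : V} (hv : deg G v ≠ 0)
    {P : Finset (V × V)} (hP : P ⊆ nbr G v ×ˢ nbr G v) :
    ∑ p ∈ P, pairWeight G v p = P.card / (deg G v : ℝ) ^ 2 := by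
  rw [Finset.sum_congr rfl (g := fun _ => (1 : ℝ) / (deg G v : ℝ) ^ 2)]
  · rw [Finset.sum_const, nsmul_eq_mul]
    ring
  · intro p hp
    have := Finset.mem_product.1 (hP hp)
    simp [pairWeight, hv, this]

lemma sum_pairWeight (G : SimpleGraph V) (v : V) : ∑ p, pairWeight G v p = 1 := by
  by_cases hv : deg G v = 0
  · simp [pairWeight, hv]
  · rw [← Finset.sum_subset (Finset.subset_univ (nbr G v ×ˢ nbr G v)),
      sum_pairWeight_of_subset hv subset_rfl, Finset.card_product]
    · have : (deg G v : ℝ) ≠ 0 := by exact_mod_cast hv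
      push_cast
      change ((deg G v : ℝ) * deg G v) / (deg G v : ℝ) ^ 2 = 1
      field_simp
    · intro p _ hp
      rw [Finset.mem_product] at hp
      simp [pairWeight, hv, hp]

lemma triWeight_eq_prod (G : SimpleGraph V) (c : V → V × V) :
    triWeight G c = ∏ v, pairWeight G v (c v) := rfl

lemma triWeight_nonneg (G : SimpleGraph V) (c : V → V × V) : 0 ≤ triWeight G c :=
  Finset.prod_nonneg fun _ _ => pairWeight_nonneg _ _ _

lemma sum_prod_eq_prod_sum (f : V → V × V → ℝ) :
    ∑ c : V → V × V, ∏ v, f v (c v) = ∏ v, ∑ p, f v p := by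
  rw [Finset.prod_univ_sum, Fintype.piFinset_univ]

lemma sum_triWeight (G : SimpleGraph V) : ∑ c, triWeight G c = 1 := by
  simp only [triWeight_eq_prod]
  rw [sum_prod_eq_prod_sum]
  simp [sum_pairWeight]

lemma triStep_nonneg (G H : SimpleGraph V) : 0 ≤ triStep G H :=
  Finset.sum_nonneg fun c _ => by
    split_ifs
    · exact triWeight_nonneg G c
    · exact le_rfl

lemma le_of_triStep_ne_zero {G H : SimpleGraph V} (h : triStep G H ≠ 0) : G ≤ H := by
  obtain ⟨c, -, hc⟩ := Finset.exists_ne_zero_of_sum_ne_zero h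
  by_cases hcH : triNext G c = H
  · exact hcH ▸ le_triNext G c
  · simp [hcH] at hc

/-- The expectation of `f` after one round is its expectation over the choices. -/
lemma sum_triStep_mul (G : SimpleGraph V) (f : SimpleGraph V → ℝ) :
    ∑ H, triStep G H * f H = ∑ c, triWeight G c * f (triNext G c) := by
  simp only [triStep, Finset.sum_mul]
  rw [Finset.sum_comm]
  refine Finset.sum_congr rfl fun c _ => ?_
  simp

lemma sum_triStep_mul_const (G : SimpleGraph V) (a : ℝ) : ∑ H, triStep G H * a = a := by
  rw [sum_triStep_mul G (fun _ => a), ← Finset.sum_mul, sum_triWeight, one_mul]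

lemma one_sub_pow_le {p : ℝ} {k : ℕ} (hp : 0 ≤ p) (hp1 : p ≤ 1) (hk : k * p ≤ 1) :
    (1 - p) ^ k ≤ 1 - k * p / 2 := by
  have h1 : 1 + k * p ≤ (1 + p) ^ k := one_add_mul_le_pow (by linarith) k
  have h2 : (1 - p) ^ k * (1 + p) ^ k ≤ 1 := by
    rw [← mul_pow]
    exact pow_le_one₀ (by nlinarith) (by nlinarith)
  have h3 : 0 ≤ (1 - p) ^ k := pow_nonneg (by linarith) k
  have hkp : 0 ≤ k * p := by positivity
  have h4 : (1 - p) ^ k * (1 + k * p) ≤ 1 :=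
    le_trans (mul_le_mul_of_nonneg_left h1 h3) h2
  by_contra! h5
  nlinarith

/-- The probability that no vertex `v` of `S` selects a pair in `P v`. -/
lemma sum_triWeight_avoid_le (G : SimpleGraph V) (S : Finset V) (P : V → Finset (V × V)) {p : ℝ}
    (hp : 0 ≤ p) (hS : S.card * p ≤ 1)
    (hdeg : ∀ v ∈ S, deg G v ≠ 0) (hsub : ∀ v ∈ S, P v ⊆ nbr G v ×ˢ nbr G v)
    (hcard : ∀ v ∈ S, p ≤ (P v).card / (deg G v : ℝ) ^ 2) :
    ∑ c : V → V × V, (if ∀ v ∈ S, c v ∉ P v then triWeight G c else 0)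
      ≤ 1 - S.card * p / 2 := by
  have hrw : ∀ c : V → V × V, (if ∀ v ∈ S, c v ∉ P v then triWeight G c else 0) =
      ∏ v, (if v ∈ S ∧ c v ∈ P v then 0 else pairWeight G v (c v)) := by
    intro c
    by_cases h : ∀ v ∈ S, c v ∉ P v
    · rw [if_pos h, triWeight_eq_prod]
      refine Finset.prod_congr rfl fun v _ => ?_
      rw [if_neg]
      rintro ⟨h1, h2⟩
      exact h v h1 h2
    · rw [if_neg h]
      push Not at h
      obtain ⟨v, h1, h2⟩ := h
      exact (Finset.prod_eq_zero (Finset.mem_univ v) (by simp [h1, h2])).symm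
  simp only [hrw]
  rw [sum_prod_eq_prod_sum (fun v q => if v ∈ S ∧ q ∈ P v then 0 else pairWeight G v q)]
  rcases S.eq_empty_or_nonempty with rfl | ⟨v₀, hv₀⟩
  · simp [sum_pairWeight]
  have hmass : ∀ v ∈ S, ∑ q, (if v ∈ S ∧ q ∈ P v then 0 else pairWeight G v q) =
      1 - (P v).card / (deg G v : ℝ) ^ 2 := by
    intro v hv
    rw [← sum_pairWeight_of_subset (hdeg v hv) (hsub v hv), ← sum_pairWeight G v,
      ← Finset.sum_filter_add_sum_filter_not Finset.univ (· ∈ P v) (pairWeight G v)]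
    simp [hv, Finset.sum_ite]
  have hmass0 : ∀ v, 0 ≤ ∑ q, (if v ∈ S ∧ q ∈ P v then 0 else pairWeight G v q) := fun v =>
    Finset.sum_nonneg fun q _ => by
      split_ifs
      · exact le_rfl
      · exact pairWeight_nonneg G v q
  have hp1 : p ≤ 1 := by
    have h1 := hmass0 v₀
    rw [hmass v₀ hv₀] at h1
    linarith [hcard v₀ hv₀]
  refine le_trans ?_ (one_sub_pow_le hp hp1 hS)
  rw [← Finset.prod_subset (Finset.subset_univ S), ← Finset.prod_const]
  · refine Finset.prod_le_prod (fun v _ => hmass0 v) fun v hv => ?_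
    rw [hmass v hv]
    linarith [hcard v hv]
  · intro v _ hv
    simp [hv, sum_pairWeight]

/-- If every round in which some `v ∈ S` selects a pair of `P v` lowers `f` from `a` to at most
`b`, and no round raises it above `a`, then the mean of `f` drops accordingly. -/
lemma sum_triStep_mul_le (G : SimpleGraph V) (f : SimpleGraph V → ℝ) {a b : ℝ} (hba : b ≤ a)
    (S : Finset V) (P : V → Finset (V × V)) {p : ℝ}
    (hp : 0 ≤ p) (hS : S.card * p ≤ 1)
    (hdeg : ∀ v ∈ S, deg G v ≠ 0) (hsub : ∀ v ∈ S, P v ⊆ nbr G v ×ˢ nbr G v)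
    (hcard : ∀ v ∈ S, p ≤ (P v).card / (deg G v : ℝ) ^ 2)
    (ha : ∀ c, f (triNext G c) ≤ a)
    (hb : ∀ c, ∀ v ∈ S, c v ∈ P v → f (triNext G c) ≤ b) :
    ∑ H, triStep G H * f H ≤ a - (a - b) * (S.card * p / 2) := by
  have h1 := sum_triWeight_avoid_le G S P hp hS hdeg hsub hcard
  rw [sum_triStep_mul]
  calc ∑ c, triWeight G c * f (triNext G c)
      ≤ ∑ c, (triWeight G c * b +
          (a - b) * (if ∀ v ∈ S, c v ∉ P v then triWeight G c else 0)) := by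
        refine Finset.sum_le_sum fun c _ => ?_
        have h0 := triWeight_nonneg G c
        split_ifs with h
        · nlinarith [ha c]
        · push Not at h
          obtain ⟨v, hv, hv'⟩ := h
          nlinarith [hb c v hv hv']
    _ = b + (a - b) * ∑ c : V → V × V, (if ∀ v ∈ S, c v ∉ P v then triWeight G c else 0) := by
        rw [Finset.sum_add_distrib, ← Finset.sum_mul, sum_triWeight, one_mul, Finset.mul_sum]
    _ ≤ _ := by nlinarith [mul_le_mul_of_nonneg_left h1 (sub_nonneg.2 hba)]

end OneRound

section TwoHop

variable {V : Type} [Fintype V] [DecidableEq V]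

/-- `w` is at distance exactly two from `u`: distinct, not adjacent, with a common neighbor. -/
def IsSecond (G : SimpleGraph V) (u w : V) : Prop :=
  w ≠ u ∧ ¬ G.Adj u w ∧ (nbr G w ∩ nbr G u).Nonempty

/-- Every neighbor of `u` has fewer than `δ / 2` neighbors at distance two from `u`. -/
def AllWeaklyTied (G : SimpleGraph V) (u : V) (δ : ℕ) : Prop :=
  ∀ v ∈ Nk G u 1, (degIn G v (Nk G u 2) : ℝ) < (δ : ℝ) / 2

/-- The inverse of the number of common neighbors of `u` and `w`, and `0` once they are
adjacent. -/
noncomputable def tiePotential (u w : V) (G : SimpleGraph V) : ℝ :=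
  if G.Adj u w then 0 else ((nbr G w ∩ nbr G u).card : ℝ)⁻¹

lemma tiePotential_nonneg (u w : V) (G : SimpleGraph V) : 0 ≤ tiePotential u w G := by
  unfold tiePotential
  split_ifs <;> positivity

lemma IsSecond.tiePotential_eq {G : SimpleGraph V} {u w : V} (h : IsSecond G u w) :
    tiePotential u w G = ((nbr G w ∩ nbr G u).card : ℝ)⁻¹ := if_neg h.2.1

lemma mem_Nk_two {G : SimpleGraph V} {u v x : V} (huv : G.Adj u v) (hvx : G.Adj v x)
    (hxu : x ≠ u) (hux : ¬ G.Adj u x) : x ∈ Nk G u 2 := by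
  have hle : G.dist u x ≤ 2 :=
    SimpleGraph.dist_le (SimpleGraph.Walk.cons huv (SimpleGraph.Walk.cons hvx .nil))
  have hr : G.Reachable u x := huv.reachable.trans hvx.reachable
  have h0 : G.dist u x ≠ 0 := fun h => hxu (hr.dist_eq_zero_iff.1 h).symm
  have h1 : G.dist u x ≠ 1 := fun h => hux (SimpleGraph.dist_eq_one_iff_adj.1 h)
  simp only [Nk, Finset.mem_filter, Finset.mem_univ, true_and]
  exact ⟨hxu, by omega⟩

lemma mem_Nk_one {G : SimpleGraph V} {u v : V} (huv : G.Adj u v) : v ∈ Nk G u 1 := by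
  simpa [Nk, huv.ne'] using huv

/-- The neighbors of a neighbor `v` of `u` are `u`, neighbors of `u`, and vertices at
distance two. -/
lemma deg_le_of_adj {G : SimpleGraph V} {u v : V} (huv : G.Adj u v) :
    deg G v ≤ 1 + (nbr G v ∩ nbr G u).card + degIn G v (Nk G u 2) := by
  have hsub : nbr G v ⊆ ({u} ∪ (nbr G v ∩ nbr G u)) ∪ (nbr G v ∩ Nk G u 2) := by
    intro x hx
    simp only [Finset.mem_union, Finset.mem_inter, Finset.mem_singleton]
    by_cases hxu : x = u
    · exact Or.inl (Or.inl hxu)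
    by_cases hux : G.Adj u x
    · exact Or.inl (Or.inr ⟨hx, mem_nbr.2 hux⟩)
    · exact Or.inr ⟨hx, mem_Nk_two huv (mem_nbr.1 hx) hxu hux⟩
  calc deg G v ≤ _ := Finset.card_le_card hsub
    _ ≤ _ := (Finset.card_union_le _ _).trans
      (Nat.add_le_add_right ((Finset.card_union_le _ _).trans (by simp)) _)

lemma card_nbr_inter_lt_deg {G : SimpleGraph V} {u v : V} (huv : G.Adj u v) :
    (nbr G v ∩ nbr G u).card < deg G u := by
  refine Finset.card_lt_card ⟨Finset.inter_subset_right, fun h => ?_⟩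
  have := (Finset.mem_inter.1 (h (mem_nbr.2 huv))).1
  exact (mem_nbr.1 this).ne rfl

lemma IsSecond.card_pos {G : SimpleGraph V} {u w : V} (h : IsSecond G u w) :
    0 < (nbr G w ∩ nbr G u).card := Finset.card_pos.2 h.2.2

/-- One additional common neighbor, or the edge `uw`, lowers the potential. -/
lemma tiePotential_le_of_le {G H : SimpleGraph V} {u w : V} (h : IsSecond G u w) (hGH : G ≤ H) :
    tiePotential u w H ≤ ((nbr G w ∩ nbr G u).card : ℝ)⁻¹ := by
  have hk : (0 : ℝ) < (nbr G w ∩ nbr G u).card := by exact_mod_cast h.card_pos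
  unfold tiePotential
  split_ifs
  · positivity
  · gcongr <;> exact nbr_mono hGH _

lemma tiePotential_le_of_new_common {G H : SimpleGraph V} {u w x : V} (hGH : G ≤ H)
    (hwx : ¬ G.Adj w x) (hux : G.Adj u x) (hHwx : H.Adj w x) :
    tiePotential u w H ≤ ((nbr G w ∩ nbr G u).card + 1 : ℝ)⁻¹ := by
  unfold tiePotential
  split_ifs
  · positivity
  · have hx : x ∉ nbr G w ∩ nbr G u := fun hx => hwx (mem_nbr.1 (Finset.mem_inter.1 hx).1)
    have hsub : insert x (nbr G w ∩ nbr G u) ⊆ nbr H w ∩ nbr H u := by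
      refine Finset.insert_subset ?_ (Finset.inter_subset_inter (nbr_mono hGH _) (nbr_mono hGH _))
      exact Finset.mem_inter.2 ⟨mem_nbr.2 hHwx, mem_nbr.2 (hGH hux)⟩
    have hcard := Finset.card_le_card hsub
    rw [Finset.card_insert_of_notMem hx] at hcard
    have : ((nbr G w ∩ nbr G u).card + 1 : ℝ) ≤ (nbr H w ∩ nbr H u).card := by
      exact_mod_cast hcard
    gcongr

/-- Degree bounds for the common neighbors of `u` and a vertex `w` at distance two. -/
lemma AllWeaklyTied.degree_bounds {G : SimpleGraph V} {u w v : V} {δ : ℕ}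
    (hG : AllWeaklyTied G u δ) (hδ : ∀ v, δ ≤ deg G v) (hu : (deg G u : ℝ) < (1 + 1 / 8) * δ)
    (h : IsSecond G u w) (hv : v ∈ nbr G w ∩ nbr G u) :
    3 ≤ δ ∧ deg G v ≤ 2 * δ ∧ δ ≤ 3 * (nbr G v ∩ nbr G u).card := by
  obtain ⟨hwv, huv⟩ := Finset.mem_inter.1 hv
  rw [mem_nbr] at hwv huv
  have h1 := hG v (mem_Nk_one huv)
  have h2 : 0 < degIn G v (Nk G u 2) :=
    Finset.card_pos.2 ⟨w, Finset.mem_inter.2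
      ⟨mem_nbr.2 hwv.symm, mem_Nk_two huv hwv.symm h.1 h.2.1⟩⟩
  have h3 : 2 * degIn G v (Nk G u 2) < δ := by
    have : (2 * degIn G v (Nk G u 2) : ℝ) < δ := by linarith
    exact_mod_cast this
  have h4 : 8 * deg G u < 9 * δ := by
    have : (8 * deg G u : ℝ) < 9 * δ := by linarith
    exact_mod_cast this
  have h5 := deg_le_of_adj huv
  have h6 := card_nbr_inter_lt_deg huv
  have h7 := hδ v
  omega

/-- One round shrinks the mean of the potential by the factor `1 - 1 / (96 n)`. -/
lemma sum_triStep_mul_tiePotential_le {G : SimpleGraph V} {u w : V} {δ n : ℕ}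
    (hG : AllWeaklyTied G u δ) (hδ : ∀ v, δ ≤ deg G v) (hu : (deg G u : ℝ) < (1 + 1 / 8) * δ)
    (hδn : δ ≤ n) (h : IsSecond G u w) :
    ∑ H, triStep G H * tiePotential u w H ≤ (1 - 1 / (96 * n)) * tiePotential u w G := by
  obtain ⟨v₀, hv₀⟩ := h.2.2
  have hb := fun v hv => hG.degree_bounds hδ hu h (v := v) hv
  have hδ3 : 3 ≤ δ := (hb v₀ hv₀).1
  have hδ3' : (3 : ℝ) ≤ δ := by exact_mod_cast hδ3
  have hn' : (δ : ℝ) ≤ n := by exact_mod_cast hδn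
  set S := nbr G w ∩ nbr G u with hS
  have hk1 : 1 ≤ S.card := h.card_pos
  have hk1' : (1 : ℝ) ≤ S.card := by exact_mod_cast hk1
  have hkd : (S.card : ℝ) ≤ 2 * δ := by
    have : (S.card : ℝ) ≤ deg G u := by
      exact_mod_cast Finset.card_le_card (Finset.inter_subset_right (s₁ := nbr G w))
    linarith
  have hdpos : ∀ v ∈ S, deg G v ≠ 0 := fun v _ => by have := hδ v; omega
  have hdsq : ∀ v ∈ S, (deg G v : ℝ) ^ 2 ≤ 4 * (δ : ℝ) ^ 2 := by
    intro v hv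
    have : (deg G v : ℝ) ≤ 2 * δ := by exact_mod_cast (hb v hv).2.1
    nlinarith [(Nat.cast_nonneg (deg G v) : (0 : ℝ) ≤ _)]
  have hdsq0 : ∀ v ∈ S, (0 : ℝ) < (deg G v : ℝ) ^ 2 := by
    intro v hv
    have : (0 : ℝ) < deg G v := by exact_mod_cast Nat.pos_of_ne_zero (hdpos v hv)
    positivity
  have hadj : ∀ v ∈ S, G.Adj v w ∧ G.Adj v u := fun v hv =>
    ⟨(mem_nbr.1 (Finset.mem_inter.1 hv).1).symm, (mem_nbr.1 (Finset.mem_inter.1 hv).2).symm⟩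
  have hrate : (1 : ℝ) / (96 * n) ≤ 1 / (96 * δ) := by gcongr
  have hmono : ∀ c, tiePotential u w (triNext G c) ≤ (S.card : ℝ)⁻¹ := fun c =>
    tiePotential_le_of_le h (le_triNext G c)
  rw [h.tiePotential_eq, ← hS]
  have hinv : (0 : ℝ) < (S.card : ℝ)⁻¹ := by positivity
  refine le_trans ?_ (mul_le_mul_of_nonneg_right (sub_le_sub_left hrate 1) hinv.le)
  by_cases hcase : 6 * S.card < δ
  · have hcase' : (6 * S.card : ℝ) < δ := by exact_mod_cast hcase
    have key := sum_triStep_mul_le G (tiePotential u w) (a := (S.card : ℝ)⁻¹)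
      (b := (S.card + 1 : ℝ)⁻¹) (by gcongr; linarith) S
      (fun v => {w} ×ˢ ((nbr G v ∩ nbr G u) \ S)) (p := 1 / (24 * δ)) (by positivity)
      (by rw [mul_one_div, div_le_one (by positivity)]; linarith)
      hdpos ?_ ?_ hmono ?_
    · refine key.trans ?_
      have : (S.card : ℝ)⁻¹ - ((S.card : ℝ)⁻¹ - (S.card + 1 : ℝ)⁻¹) *
          (S.card * (1 / (24 * δ)) / 2) =
          (1 - S.card / (48 * δ * (S.card + 1))) * (S.card : ℝ)⁻¹ := by
        field_simp
        ring
      rw [this]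
      refine mul_le_mul_of_nonneg_right (sub_le_sub_left ?_ 1) hinv.le
      rw [div_le_div_iff₀ (by positivity) (by positivity)]
      nlinarith
    · intro v hv
      refine Finset.product_subset_product ?_ ?_
      · simpa using mem_nbr.2 (hadj v hv).1
      · exact Finset.sdiff_subset.trans Finset.inter_subset_left
    · intro v hv
      have hc : δ ≤ 6 * ((nbr G v ∩ nbr G u) \ S).card := by
        have h1 := Finset.le_card_sdiff S (nbr G v ∩ nbr G u)
        have h2 := (hb v hv).2.2
        omega
      have hc' : (δ : ℝ) ≤ 6 * ((nbr G v ∩ nbr G u) \ S).card := by exact_mod_cast hc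
      rw [Finset.card_product, Finset.card_singleton, one_mul,
        div_le_div_iff₀ (by positivity) (hdsq0 v hv)]
      nlinarith [hdsq v hv]
    · rintro c v hv hcv
      obtain ⟨h1, h2⟩ := Finset.mem_product.1 hcv
      obtain ⟨h3, h4⟩ := Finset.mem_sdiff.1 h2
      have hux := (Finset.mem_inter.1 h3).2
      have hwx : ¬ G.Adj w (c v).2 := fun hh =>
        h4 (Finset.mem_inter.2 ⟨mem_nbr.2 hh, hux⟩)
      refine tiePotential_le_of_new_common (le_triNext G c) hwx (mem_nbr.1 hux)
        (triNext_adj (v := v) (Prod.ext (Finset.mem_singleton.1 h1) rfl) ?_)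
      intro hh
      exact h.2.1 (hh ▸ mem_nbr.1 hux)
  · have hcase' : (δ : ℝ) ≤ 6 * S.card := by exact_mod_cast not_lt.1 hcase
    have key := sum_triStep_mul_le G (tiePotential u w) (a := (S.card : ℝ)⁻¹)
      (b := 0) hinv.le S (fun _ => {(u, w)}) (p := 1 / (4 * (δ : ℝ) ^ 2)) (by positivity)
      (by rw [mul_one_div, div_le_one (by positivity)]; nlinarith)
      hdpos ?_ ?_ hmono ?_
    · refine key.trans ?_
      have : (S.card : ℝ)⁻¹ - ((S.card : ℝ)⁻¹ - 0) *
          (S.card * (1 / (4 * (δ : ℝ) ^ 2)) / 2) =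
          (1 - S.card / (8 * (δ : ℝ) ^ 2)) * (S.card : ℝ)⁻¹ := by
        field_simp
        ring
      rw [this]
      refine mul_le_mul_of_nonneg_right (sub_le_sub_left ?_ 1) hinv.le
      rw [div_le_div_iff₀ (by positivity) (by positivity)]
      nlinarith
    · intro v hv
      simpa [mem_nbr] using (hadj v hv).symm
    · intro v hv
      rw [Finset.card_singleton, div_le_div_iff₀ (by positivity) (hdsq0 v hv)]
      simpa using hdsq v hv
    · intro c v hv hcv
      have : (triNext G c).Adj u w := triNext_adj (Finset.mem_singleton.1 hcv) h.1.symm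
      simp [tiePotential, this]

end TwoHop

section Trajectory

variable {V : Type} [Fintype V] [DecidableEq V]

lemma IsSecond.of_le_of_le {G M H : SimpleGraph V} {u w : V} (h : IsSecond G u w)
    (hGM : G ≤ M) (hMH : M ≤ H) (hH : ¬ H.Adj u w) : IsSecond M u w :=
  ⟨h.1, fun hM => hH (hMH hM),
    h.2.2.mono (Finset.inter_subset_inter (nbr_mono hGM _) (nbr_mono hGM _))⟩

lemma exists_isSecond {G : SimpleGraph V} (hG : G.Connected) {u : V}
    (hu : deg G u + 1 < Fintype.card V) : ∃ w, IsSecond G u w := by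
  obtain ⟨x, hx⟩ : ∃ x, x ∉ insert u (nbr G u) := by
    by_contra! hall
    have h1 := Finset.card_le_card (fun x _ => hall x : Finset.univ ⊆ insert u (nbr G u))
    have h2 := Finset.card_insert_le u (nbr G u)
    rw [Finset.card_univ] at h1
    have h3 : deg G u = (nbr G u).card := rfl
    omega
  obtain ⟨p⟩ := hG.preconnected u x
  obtain ⟨d, -, hd1, hd2⟩ := p.exists_boundary_dart (↑(insert u (nbr G u)) : Set V)
    (by simp) (by simpa using hx)
  simp only [Finset.coe_insert, Set.mem_insert_iff, Finset.mem_coe, mem_nbr, not_or] at hd1 hd2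
  refine ⟨d.snd, hd2.1, hd2.2, d.fst, Finset.mem_inter.2 ⟨mem_nbr.2 d.adj.symm, ?_⟩⟩
  rcases hd1 with hd1 | hd1
  · exact absurd (hd1 ▸ d.adj) hd2.2
  · exact mem_nbr.2 hd1

/-- If the degree of `u` stays below both `2 δ₀` and `n - 1` for three periods of length `L`, then
during one of them some vertex at distance two from `u` fails to become adjacent to `u`. -/
lemma exists_isSecond_not_adj {g : ℕ → SimpleGraph V} (hg : Monotone g) (hconn : (g 0).Connected)
    {u : V} {L : ℕ} (h2 : deg (g (3 * L)) u < 2 * minDeg (g 0))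
    (hn : deg (g (3 * L)) u + 1 < Fintype.card V) :
    ∃ j < 3, ∃ w, IsSecond (g (j * L)) u w ∧ ¬ (g ((j + 1) * L)).Adj u w := by
  by_contra! hall
  have hj0 := fun w => hall 0 (by norm_num) w
  have hj1 := fun w => hall 1 (by norm_num) w
  have hj2 := fun w => hall 2 (by norm_num) w
  norm_num at hj0 hj1 hj2
  have h03 : g 0 ≤ g (3 * L) := hg (Nat.zero_le _)
  have h02 : g 0 ≤ g (2 * L) := hg (Nat.zero_le _)
  have h01 : g 0 ≤ g L := hg (Nat.zero_le _)
  have h13 : g L ≤ g (3 * L) := hg (by omega)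
  have h23 : g (2 * L) ≤ g (3 * L) := hg (by omega)
  obtain ⟨x, hx⟩ := exists_isSecond (hconn.mono h01)
    (lt_of_le_of_lt (Nat.add_le_add_right (deg_mono h13 u) 1) hn)
  have hxu : (g (2 * L)).Adj u x := hj1 x hx
  have hx0 : ¬ (g 0).Adj u x := fun h => hx.2.1 (h01 h)
  have hdisj : Disjoint (nbr (g 0) x) (nbr (g 0) u) := by
    rw [Finset.disjoint_iff_inter_eq_empty, ← Finset.not_nonempty_iff_eq_empty]
    exact fun hne => hx.2.1 (hj0 x ⟨hx.1, hx0, hne⟩)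
  have hsub : nbr (g 0) x ∪ nbr (g 0) u ⊆ nbr (g (3 * L)) u := by
    refine Finset.union_subset (fun y hy => mem_nbr.2 ?_) (nbr_mono h03 u)
    rw [mem_nbr] at hy
    by_contra hny
    have hyu : y ≠ u := fun h => hx0 (h ▸ hy.symm)
    have hny2 : ¬ (g (2 * L)).Adj u y := fun h => hny (h23 h)
    exact hny (hj2 y ⟨hyu, hny2, x,
      Finset.mem_inter.2 ⟨mem_nbr.2 (h02 hy.symm), mem_nbr.2 hxu⟩⟩)
  have hcard := Finset.card_le_card hsub
  rw [Finset.card_union_of_disjoint hdisj] at hcard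
  have hx1 := minDeg_le_deg (g 0) x
  have hu1 := minDeg_le_deg (g 0) u
  unfold deg at *
  omega

/-- The states visited at time `t` by a trajectory along which all neighbors of `u` are weakly
tied and `w` stays at distance two from `u` during the period `[a, a + L]`. -/
def StaysSecond (u w : V) (δ T a L t : ℕ) (G : SimpleGraph V) : Prop :=
  (∀ v, δ ≤ deg G v) ∧ (deg G u : ℝ) < (1 + 1 / 8) * δ ∧ (t < T → AllWeaklyTied G u δ) ∧
    (a ≤ t → t ≤ a + L → IsSecond G u w)

lemma sum_path_staysSecond_le (G0 : SimpleGraph V) (u w : V) {δ T a L n : ℕ}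
    (hn : Fintype.card V = n) (hL : 0 < L) (haL : a + L ≤ T) :
    ∑ s : Fin (T + 1) → SimpleGraph V,
      (if s 0 = G0 ∧ ∀ i : Fin (T + 1), StaysSecond u w δ T a L i (s i)
        then ∏ t : Fin T, triStep (s t.castSucc) (s t.succ) else 0)
      ≤ n * (1 - 1 / (96 * n)) ^ L := by
  have hn0 : 0 < n := hn ▸ Fintype.card_pos_iff.2 ⟨u⟩
  have hn1 : (1 : ℝ) ≤ n := by exact_mod_cast hn0
  set r : ℝ := 1 - 1 / (96 * n) with hr
  have hr0 : 0 ≤ r := by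
    rw [hr, sub_nonneg, div_le_one (by positivity)]
    linarith
  have hcard : ∀ G : SimpleGraph V, IsSecond G u w →
      1 ≤ n * tiePotential u w G ∧ tiePotential u w G ≤ 1 := by
    intro G hG
    have h1 : (1 : ℝ) ≤ (nbr G w ∩ nbr G u).card := by exact_mod_cast hG.card_pos
    have h2 : ((nbr G w ∩ nbr G u).card : ℝ) ≤ n := by
      exact_mod_cast hn ▸ Finset.card_le_univ _
    rw [hG.tiePotential_eq]
    refine ⟨?_, inv_le_one_of_one_le₀ h1⟩
    rw [← div_eq_mul_inv, le_div_iff₀ (by positivity)]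
    linarith
  have hstep : ∀ t < T, ∀ G, StaysSecond u w δ T a L t G → a ≤ t → t ≤ a + L →
      ∑ H, triStep G H * tiePotential u w H ≤ r * tiePotential u w G := by
    rintro t ht G ⟨h1, h2, h3, h4⟩ hat htL
    refine sum_triStep_mul_tiePotential_le (h3 ht) h1 h2 ((h1 u).trans ?_) (h4 hat htL)
    exact hn ▸ Finset.card_le_univ _
  let h : ℕ → SimpleGraph V → ℝ := fun t G =>
    if t ≤ a then n * r ^ L
    else if t ≤ a + L then n * r ^ (a + L - t) * tiePotential u w G else 1
  have hmain := sum_path_le_of_supermartingale triStep triStep_nonneg T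
    (StaysSecond u w δ T a L) h ?_ ?_ ?_ G0
  · simpa [h] using hmain
  · intro t G
    have := tiePotential_nonneg u w G
    simp only [h]
    split_ifs <;> positivity
  · rintro G ⟨-, -, -, h4⟩
    simp only [h]
    rw [if_neg (by omega)]
    split_ifs with hT
    · obtain rfl : T = a + L := by omega
      simpa using (hcard G (h4 (by omega) le_rfl)).1
    · exact le_rfl
  · intro t ht G hG
    simp only [h]
    rcases lt_trichotomy t a with hta | rfl | hta
    · rw [if_pos hta.le]
      simp only [if_pos (by omega : t + 1 ≤ a), sum_triStep_mul_const, le_refl]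
    · have h1 := hstep t ht G hG le_rfl (by omega)
      have h2 := (hcard G (hG.2.2.2 le_rfl (by omega))).2
      simp only [if_neg (by omega : ¬ t + 1 ≤ t), if_pos (by omega : t + 1 ≤ t + L), le_refl,
        if_true, mul_left_comm (triStep _ _), ← Finset.mul_sum]
      obtain ⟨L, rfl⟩ : ∃ L', L = L' + 1 := ⟨L - 1, by omega⟩
      rw [show t + (L + 1) - (t + 1) = L by omega, pow_succ, ← mul_assoc]
      refine mul_le_mul_of_nonneg_left (h1.trans ?_) (by positivity)
      nlinarith
    · rcases lt_trichotomy t (a + L) with htL | rfl | htL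
      · have h1 := hstep t ht G hG hta.le htL.le
        simp only [if_neg (by omega : ¬ t + 1 ≤ a), if_pos (by omega : t + 1 ≤ a + L),
          if_neg (by omega : ¬ t ≤ a), if_pos htL.le,
          mul_left_comm (triStep _ _), ← Finset.mul_sum]
        rw [show a + L - t = (a + L - (t + 1)) + 1 by omega, pow_succ, ← mul_assoc,
          mul_assoc _ r]
        exact mul_le_mul_of_nonneg_left h1 (by positivity)
      · have h2 := (hcard G (hG.2.2.2 (by omega) le_rfl)).1
        simp only [if_neg (by omega : ¬ a + L + 1 ≤ a), if_neg (by omega : ¬ a + L + 1 ≤ a + L),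
          if_neg (by omega : ¬ a + L ≤ a), le_refl, if_true, sum_triStep_mul_const]
        simpa using h2
      · simp only [if_neg (by omega : ¬ t + 1 ≤ a), if_neg (by omega : ¬ t + 1 ≤ a + L),
          if_neg (by omega : ¬ t ≤ a), if_neg (by omega : ¬ t ≤ a + L), sum_triStep_mul_const,
          le_refl]

lemma trajProb_allWeaklyTied_le {G0 : SimpleGraph V} (hG0 : G0.Connected) (u : V) {n T L : ℕ}
    (hn : Fintype.card V = n) (hL : 0 < L) (hLT : 3 * L ≤ T) :
    trajProb triStep G0 T (fun g =>
      (∀ t < T, AllWeaklyTied (g t) u (minDeg G0)) ∧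
        (deg (g T) u : ℝ) < min ((1 + 1/8) * (minDeg G0 : ℝ)) ((n : ℝ) - 1))
      ≤ 3 * (n : ℝ) ^ 2 * (1 - 1 / (96 * n)) ^ L := by
  set F : Fin 3 → V → (Fin (T + 1) → SimpleGraph V) → ℝ := fun j w s =>
    if s 0 = G0 ∧ ∀ i : Fin (T + 1), StaysSecond u w (minDeg G0) T (j * L) L i (s i)
      then ∏ t : Fin T, triStep (s t.castSucc) (s t.succ) else 0 with hF
  have hprod : ∀ s : Fin (T + 1) → SimpleGraph V,
      0 ≤ ∏ t : Fin T, triStep (s t.castSucc) (s t.succ) := fun s =>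
    Finset.prod_nonneg fun t _ => triStep_nonneg _ _
  have hF0 : ∀ j w s, 0 ≤ F j w s := by
    intro j w s
    simp only [hF]
    split_ifs
    · exact hprod s
    · exact le_rfl
  calc _ ≤ ∑ s, ∑ j, ∑ w, F j w s := ?_
    _ = ∑ j, ∑ w, ∑ s, F j w s := by
      rw [Finset.sum_comm]
      exact Finset.sum_congr rfl fun j _ => Finset.sum_comm
    _ ≤ ∑ _j : Fin 3, ∑ _w : V, (n : ℝ) * (1 - 1 / (96 * n)) ^ L := by
      refine Finset.sum_le_sum fun j _ => Finset.sum_le_sum fun w _ =>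
        sum_path_staysSecond_le G0 u w hn hL ?_
      have := Nat.mul_le_mul_right L (show (j : ℕ) + 1 ≤ 3 by omega)
      linarith
    _ = _ := by
      simp only [Finset.sum_const, Finset.card_univ, hn, Fintype.card_fin, nsmul_eq_mul]
      push_cast
      ring
  refine Finset.sum_le_sum fun s _ => ?_
  have hnonneg : 0 ≤ ∑ j, ∑ w, F j w s :=
    Finset.sum_nonneg fun j _ => Finset.sum_nonneg fun w _ => hF0 j w s
  split_ifs with hE
  swap
  · exact hnonneg
  by_cases hs : ∏ t : Fin T, triStep (s t.castSucc) (s t.succ) = 0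
  · exact hs ▸ hnonneg
  have hsmono : Monotone s := Fin.monotone_iff_le_succ.2 fun t =>
    le_of_triStep_ne_zero (Finset.prod_ne_zero_iff.1 hs t (Finset.mem_univ t))
  obtain ⟨hs0, hweak, hdeg⟩ := hE
  set g : ℕ → SimpleGraph V :=
    fun t => s ⟨min t T, Nat.lt_succ_of_le (Nat.min_le_right t T)⟩ with hg
  have hgmono : Monotone g := fun t t' htt => hsmono (by
    simp only [Fin.mk_le_mk]
    omega)
  have hg0 : g 0 = G0 := by
    rw [← hs0]
    simp [hg]
  have hgi : ∀ i : Fin (T + 1), g i = s i := by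
    intro i
    simp only [hg]
    congr 1
    ext
    simp only
    omega
  obtain ⟨hd1, hd2⟩ := lt_min_iff.1 hdeg
  have hle : ∀ t ≤ T, (deg (g t) u : ℝ) ≤ deg (g T) u := fun t ht => by
    exact_mod_cast deg_mono (hgmono ht) u
  obtain ⟨j, hj, w, hw1, hw2⟩ := exists_isSecond_not_adj hgmono (hg0 ▸ hG0) (u := u) (L := L)
    (by
      have h1 := hle _ hLT
      have h2 : (0 : ℝ) ≤ minDeg G0 := Nat.cast_nonneg _
      have : (deg (g (3 * L)) u : ℝ) < 2 * minDeg G0 := by linarith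
      rw [hg0]
      exact_mod_cast this)
    (by
      have h1 := hle _ hLT
      have : (deg (g (3 * L)) u : ℝ) + 1 < n := by linarith
      rw [hn]
      exact_mod_cast this)
  have hstay : ∀ i : Fin (T + 1), StaysSecond u w (minDeg G0) T (j * L) L i (s i) := by
    intro i
    rw [← hgi i]
    refine ⟨fun v => ?_, ?_, fun hi => hweak i hi, fun h1 h2 => ?_⟩
    · refine (minDeg_le_deg G0 v).trans (deg_mono ?_ v)
      exact hg0 ▸ hgmono (Nat.zero_le _)
    · exact (hle i (by omega)).trans_lt hd1
    · exact hw1.of_le_of_le (hgmono h1) (hgmono (by linarith)) hw2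
  calc _ = F ⟨j, hj⟩ w s := by
        simp only [hF]
        rw [if_pos ⟨hs0, hstay⟩]
    _ ≤ ∑ w, F ⟨j, hj⟩ w s :=
        Finset.single_le_sum (fun w _ => hF0 ⟨j, hj⟩ w s) (Finset.mem_univ w)
    _ ≤ _ := Finset.single_le_sum (f := fun j => ∑ w, F j w s)
        (fun j _ => Finset.sum_nonneg fun w _ => hF0 j w s) (Finset.mem_univ _)

/-- After `576 n log n` rounds the failure bound is at most `1 / n²`. -/
lemma three_mul_sq_mul_pow_le {n L : ℕ} (hn : 2 ≤ n) (hL : 576 * n * Real.log n ≤ L) :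
    3 * (n : ℝ) ^ 2 * (1 - 1 / (96 * n)) ^ L ≤ 1 / (n : ℝ) ^ 2 := by
  have hn2 : (2 : ℝ) ≤ n := by exact_mod_cast hn
  have hn0 : (0 : ℝ) < n := by linarith
  have hbase : (0 : ℝ) ≤ 1 - 1 / (96 * n) := by
    rw [sub_nonneg, div_le_one (by positivity)]
    linarith
  have hpow : (1 - 1 / (96 * n) : ℝ) ^ L ≤ 1 / (n : ℝ) ^ 6 := by
    calc (1 - 1 / (96 * n) : ℝ) ^ L ≤ Real.exp (-(1 / (96 * n))) ^ L :=
          pow_le_pow_left₀ hbase (Real.one_sub_le_exp_neg _) L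
      _ = Real.exp (-(L / (96 * n))) := by
          rw [← Real.exp_nat_mul]
          ring_nf
      _ ≤ Real.exp (-(6 * Real.log n)) := by
          refine Real.exp_le_exp.2 (neg_le_neg ?_)
          rw [le_div_iff₀ (by positivity)]
          linarith
      _ = 1 / (n : ℝ) ^ 6 := by
          rw [Real.exp_neg, one_div, show 6 * Real.log n = ((6 : ℕ) : ℝ) * Real.log n by norm_num,
            Real.exp_nat_mul, Real.exp_log hn0]
  calc _ ≤ 3 * (n : ℝ) ^ 2 * (1 / (n : ℝ) ^ 6) := by gcongr
    _ ≤ _ := by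
      rw [mul_one_div, div_le_div_iff₀ (by positivity) (by positivity)]
      have h4 : (3 : ℝ) ≤ n ^ 2 := by nlinarith
      have h5 : (0 : ℝ) < (n : ℝ) ^ 4 := by positivity
      nlinarith [mul_le_mul_of_nonneg_right h4 h5.le]

end Trajectory

/-- There is a constant `C > 0` such that for every `n ≥ 2`, every
connected initial graph `G₀` on `n` vertices with minimum degree `δ₀`, and every vertex
`u`, with `T = ⌈C·n·ln n⌉`: the probability, over the trajectory of the triangulation
process started at `G₀`, that both (i) for every round `t < T` every vertex of
`N_t¹(u)` is weakly tied to `N_t²(u)` (i.e. has fewer than `δ₀/2` neighbors there), and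
(ii) `d_T(u) < min {(1 + 1/8)·δ₀, n − 1}`, is at most `1/n²`. -/
theorem triangulation_all_weakly_tied :
    ∃ C : ℝ, 0 < C ∧
      ∀ (V : Type) [Fintype V] [DecidableEq V] (n : ℕ), 2 ≤ n → Fintype.card V = n →
        ∀ (G0 : SimpleGraph V), G0.Connected → ∀ u : V,
          ∀ T : ℕ, T = ⌈C * n * Real.log n⌉₊ →
            trajProb triStep G0 T (fun g =>
              (∀ t < T, ∀ v ∈ Nk (g t) u 1,
                  (degIn (g t) v (Nk (g t) u 2) : ℝ) < (minDeg G0 : ℝ) / 2)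
              ∧ (deg (g T) u : ℝ) < min ((1 + 1/8) * (minDeg G0 : ℝ)) ((n : ℝ) - 1))
            ≤ 1 / (n : ℝ) ^ 2 := by
  refine ⟨1731, by norm_num, ?_⟩
  intro V _ _ n hn hcard G0 hconn u T hT
  have hn2 : (2 : ℝ) ≤ n := by exact_mod_cast hn
  have hlog2 := Real.log_two_gt_d9
  have hlog : Real.log 2 ≤ Real.log n := Real.log_le_log (by norm_num) hn2
  have hnlog : 1 ≤ n * Real.log n := by nlinarith
  have hLT : 3 * ⌈576 * n * Real.log n⌉₊ ≤ T := by
    have h1 := Nat.ceil_lt_add_one (show 0 ≤ 576 * n * Real.log n by nlinarith)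
    have h2 := Nat.le_ceil (1731 * n * Real.log n)
    rw [← hT] at h2
    have h3 : (3 * ⌈576 * n * Real.log n⌉₊ : ℝ) ≤ T := by nlinarith
    exact_mod_cast h3
  exact (trajProb_allWeaklyTied_le hconn u hcard
    (Nat.ceil_pos.2 (by nlinarith)) hLT).trans
    (three_mul_sq_mul_pow_le hn (Nat.le_ceil _))
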